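/- Let Ω ⊂ ℝᴺ be a bounded open set, ψ : ∂Ω → ℝ continuous, and suppose (Ω, ψ) satisfies the bounded slope condition with some constant Q > 0. Assume in addition that α(ρ) := ρ f''(ρ)/f'(ρ) has a finite limit as ρ → 0⁺ and that α∞ := lim_{ρ→+∞} α(ρ) exists and is strictly positive; set α(0) := 0. Then every solution u of the variational problem (P) is a viscosity solution in Ω of −[α(‖∇u‖) − 1]·Δ∞u − ‖∇u‖²·Δu = 0. -/

import Mathlib

open Set MeasureTheory Metric Filter
open scoped RealInnerProductSpace Topology Classical

noncomputable section

abbrev EN (N : ℕ) := EuclideanSpace ℝ (Fin N)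

/-- A function is Lipschitz on a set (with some constant). -/
def LipOn {N : ℕ} (w : EN N → ℝ) (s : Set (EN N)) : Prop := ∃ L : NNReal, LipschitzOnWith L w s

/-- The functional `J(w) = ∫_Ω f(‖∇w‖)`, with `∇w` the a.e.-defined (Rademacher) gradient. -/
def J {N : ℕ} (f : ℝ → ℝ) (Ω : Set (EN N)) (w : EN N → ℝ) : ℝ := ∫ x in Ω, f ‖gradient w x‖

/-- The (one-sided at `0`) derivative of `f` on `[0,∞)`. -/
def dtop (f : ℝ → ℝ) : ℝ → ℝ := derivWithin f (Set.Ici 0)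

/-- Standing assumptions on the Lagrangian `f`. -/
def StdF (f : ℝ → ℝ) : Prop :=
  StrictConvexOn ℝ (Set.Ici 0) f ∧ ContDiffOn ℝ 1 f (Set.Ici 0) ∧
  ContDiffOn ℝ 2 f (Set.Ioi 0) ∧
  (∃ lam : NNReal, 0 < lam ∧ lam < 1 ∧ ∀ K : Set ℝ, IsCompact K → K ⊆ Set.Ioi 0 →
    ∃ C : NNReal, HolderOnWith C lam (deriv (dtop f)) K) ∧
  0 < dtop f 0

/-- `u` solves the variational problem (P) for the Lagrangian `f`. -/
def SolvesP {N : ℕ} (f : ℝ → ℝ) (Ω : Set (EN N)) (ψ u : EN N → ℝ) : Prop :=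
  LipOn u (closure Ω) ∧ EqOn u ψ (frontier Ω) ∧
  ∀ w : EN N → ℝ, LipOn w (closure Ω) → EqOn w ψ (frontier Ω) → J f Ω u ≤ J f Ω w

/-- `(Ω, ψ)` satisfies the bounded slope condition with constant `Q`. -/
def BSC {N : ℕ} (Ω : Set (EN N)) (ψ : EN N → ℝ) (Q : ℝ) : Prop :=
  ∀ x₀ ∈ frontier Ω, ∃ a b : EN N, ∃ c d : ℝ,
    ‖a‖ ≤ Q ∧ ‖b‖ ≤ Q ∧
    (∀ x ∈ frontier Ω, ⟪a, x⟫ + c ≤ ψ x ∧ ψ x ≤ ⟪b, x⟫ + d) ∧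
    ⟪a, x₀⟫ + c = ψ x₀ ∧ ⟪b, x₀⟫ + d = ψ x₀

/-- `w` is a viscosity solution of `F(∇w, ∇²w) = 0` in `Ω`: `w` is continuous on `Ω` and, for
every `C²` test function `φ` such that `w − φ` has a local maximum (resp. minimum) on `Ω` at
`x`, one has `F(∇φ(x), ∇²φ(x)) ≤ 0` (resp. `≥ 0`). The Hessian is encoded as the operator
`fderiv ℝ (gradient φ) x`. -/
def ViscositySol {N : ℕ} (Ω : Set (EN N)) (F : EN N → (EN N →L[ℝ] EN N) → ℝ)
    (w : EN N → ℝ) : Prop :=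
  ContinuousOn w Ω ∧
  (∀ x ∈ Ω, ∀ φ : EN N → ℝ, ContDiff ℝ 2 φ →
    IsLocalMaxOn (fun y => w y - φ y) Ω x →
    F (gradient φ x) (fderiv ℝ (gradient φ) x) ≤ 0) ∧
  (∀ x ∈ Ω, ∀ φ : EN N → ℝ, ContDiff ℝ 2 φ →
    IsLocalMinOn (fun y => w y - φ y) Ω x →
    0 ≤ F (gradient φ x) (fderiv ℝ (gradient φ) x))

section Lagrangian

variable {f : ℝ → ℝ}

theorem StdF.convexOn (hf : StdF f) : ConvexOn ℝ (Set.Ici 0) f := hf.1.convexOn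

theorem StdF.differentiableOn (hf : StdF f) : DifferentiableOn ℝ f (Set.Ici 0) :=
  hf.2.1.differentiableOn one_ne_zero

theorem StdF.dtop_pos (hf : StdF f) {a : ℝ} (ha : 0 ≤ a) : 0 < dtop f a :=
  hf.2.2.2.2.trans_le
    (hf.convexOn.monotoneOn_derivWithin hf.differentiableOn (Set.mem_Ici.2 le_rfl) ha ha)

theorem StdF.add_dtop_mul_sub_le (hf : StdF f) {a b : ℝ} (ha : 0 ≤ a) (hb : 0 ≤ b) :
    f a + dtop f a * (b - a) ≤ f b := by
  rcases lt_trichotomy a b with h | rfl | h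
  · have := hf.convexOn.derivWithin_le_slope ha hb h (hf.differentiableOn a ha)
    rw [slope_def_field, le_div_iff₀ (sub_pos.2 h)] at this
    simp only [dtop]
    linarith
  · simp
  · have := hf.convexOn.slope_le_derivWithin hb ha h (hf.differentiableOn a ha)
    rw [slope_def_field, div_le_iff₀ (sub_pos.2 h)] at this
    simp only [dtop]
    linarith

theorem StdF.contDiffAt_dtop (hf : StdF f) {a : ℝ} (ha : 0 < a) : ContDiffAt ℝ 1 (dtop f) a := by
  have h : ContDiffOn ℝ 1 (deriv f) (Set.Ioi 0) :=
    hf.2.2.1.deriv_of_isOpen isOpen_Ioi (by norm_num)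
  refine (h.contDiffAt (Ioi_mem_nhds ha)).congr_of_eventuallyEq ?_
  filter_upwards [Ioi_mem_nhds ha] with x hx
  exact derivWithin_of_mem_nhds (Ici_mem_nhds hx)

variable {N : ℕ}

theorem StdF.continuous_comp_norm (hf : StdF f) : Continuous fun p : EN N => f ‖p‖ :=
  hf.2.1.continuousOn.comp_continuous continuous_norm fun p => norm_nonneg p

/-- The gradient `f'(‖p‖) p / ‖p‖` of the radial function `p ↦ f ‖p‖`. -/
def flux (f : ℝ → ℝ) (p : EN N) : EN N := (dtop f ‖p‖ / ‖p‖) • p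

theorem StdF.add_inner_flux_le (hf : StdF f) {p : EN N} (hp : p ≠ 0) (q : EN N) :
    f ‖p‖ + ⟪flux f p, q - p⟫ ≤ f ‖q‖ := by
  have h := hf.add_dtop_mul_sub_le (norm_nonneg p) (norm_nonneg q)
  have hp' := norm_pos_iff.2 hp
  have hd := (hf.dtop_pos (norm_nonneg p)).le
  have hi : ⟪p, q - p⟫ ≤ ‖p‖ * (‖q‖ - ‖p‖) := by
    rw [inner_sub_right, real_inner_self_eq_norm_sq]
    nlinarith [real_inner_le_norm p q]
  have h2 : ⟪flux f p, q - p⟫ ≤ dtop f ‖p‖ * (‖q‖ - ‖p‖) := by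
    rw [flux, real_inner_smul_left]
    calc _ ≤ dtop f ‖p‖ / ‖p‖ * (‖p‖ * (‖q‖ - ‖p‖)) := by gcongr
      _ = _ := by field_simp
  linarith

theorem StdF.contDiffAt_flux (hf : StdF f) {p : EN N} (hp : p ≠ 0) :
    ContDiffAt ℝ 1 (flux f) p :=
  (((hf.contDiffAt_dtop (norm_pos_iff.2 hp)).comp p (contDiffAt_norm ℝ hp)).div
    (contDiffAt_norm ℝ hp) (norm_ne_zero_iff.2 hp)).smul contDiffAt_id

theorem hasFDerivAt_norm_of_ne_zero {p : EN N} (hp : p ≠ 0) :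
    HasFDerivAt (fun q : EN N => ‖q‖) (‖p‖⁻¹ • innerSL ℝ p) p := by
  have h := ((hasStrictFDerivAt_norm_sq p).hasFDerivAt).sqrt (by simpa using hp)
  simp only [norm_nonneg, Real.sqrt_sq] at h
  refine h.congr_fderiv ?_
  ext v
  simp
  ring

theorem StdF.trace_fderiv_flux_comp (hf : StdF f) {G : EN N → EN N} {H : EN N →L[ℝ] EN N}
    {x : EN N} (hG : HasFDerivAt G H x) (hx : G x ≠ 0) :
    ‖G x‖ ^ 3 / dtop f ‖G x‖ *
        LinearMap.trace ℝ (EN N) (fderiv ℝ (fun y => flux f (G y)) x).toLinearMap =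
      (‖G x‖ * deriv (dtop f) ‖G x‖ / dtop f ‖G x‖ - 1) * ⟪H (G x), G x⟫
        + ‖G x‖ ^ 2 * LinearMap.trace ℝ (EN N) H.toLinearMap := by
  have hpos := norm_pos_iff.2 hx
  have hd := (hf.dtop_pos (norm_nonneg (G x)))
  have h1 : HasDerivAt (fun ρ => dtop f ρ / ρ)
      ((deriv (dtop f) ‖G x‖ * ‖G x‖ - dtop f ‖G x‖ * 1) / ‖G x‖ ^ 2) ‖G x‖ :=
    ((hf.contDiffAt_dtop hpos).differentiableAt one_ne_zero).hasDerivAt.div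
      (hasDerivAt_id _) hpos.ne'
  have h2 := (h1.comp_hasFDerivAt (G x) (hasFDerivAt_norm_of_ne_zero hx)).comp x hG
  have h3 := h2.smul hG
  have h4 : fderiv ℝ (fun y => flux f (G y)) x = _ := h3.fderiv
  rw [h4]
  simp only [ContinuousLinearMap.toLinearMap_add, ContinuousLinearMap.toLinearMap_smul, map_add,
    map_smul, ContinuousLinearMap.coe_smulRight, LinearMap.trace_smulRight, Function.comp]
  simp [real_inner_comm]
  field_simp
  ring

end Lagrangian

section IntegrationByParts

variable {N : ℕ}

theorem measurable_gradient (v : EN N → ℝ) : Measurable (gradient v) :=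
  (InnerProductSpace.toDual ℝ (EN N)).symm.continuous.measurable.comp (measurable_fderiv ℝ v)

theorem norm_gradient_le {v : EN N → ℝ} {s : Set (EN N)} {x : EN N} (hs : s ∈ 𝓝 x) {L : NNReal}
    (hv : LipschitzOnWith L v s) : ‖gradient v x‖ ≤ L := by
  simpa [gradient] using norm_fderiv_le_of_lipschitzOn ℝ hs hv

theorem LipschitzWith.integral_inner_gradient {v : EN N → ℝ} {L : NNReal} (hv : LipschitzWith L v)
    (hvc : HasCompactSupport v) {B : EN N → EN N} (hB : ContDiff ℝ 1 B)
    (hBc : HasCompactSupport B) :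
    ∫ x, ⟪B x, gradient v x⟫ =
      -∫ x, LinearMap.trace ℝ (EN N) (fderiv ℝ B x).toLinearMap * v x := by
  obtain ⟨K, hK⟩ := hB.lipschitzWith_of_hasCompactSupport hBc one_ne_zero
  let e := EuclideanSpace.basisFun (Fin N) ℝ
  have hBd : Differentiable ℝ B := hB.differentiable one_ne_zero
  have hBi : ∀ i, ContDiff ℝ 1 fun x => ⟪e i, B x⟫ := fun i => contDiff_const.inner ℝ hB
  have hBic : ∀ i, HasCompactSupport fun x => ⟪e i, B x⟫ := fun i =>
    hBc.comp_left (g := fun y => ⟪e i, y⟫) (by simp)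
  have hlip : ∀ i, ∃ C, LipschitzWith C fun x => ⟪e i, B x⟫ := fun i =>
    (hBi i).lipschitzWith_of_hasCompactSupport (hBic i) one_ne_zero
  have hfd : ∀ i x, fderiv ℝ (fun x => ⟪e i, B x⟫) x (e i) = ⟪e i, fderiv ℝ B x (e i)⟫ := by
    intro i x
    have := ((innerSL ℝ (e i)).hasFDerivAt.comp x (hBd x).hasFDerivAt).fderiv
    have h2 : fderiv ℝ (fun x => ⟪e i, B x⟫) x = (innerSL ℝ (e i)).comp (fderiv ℝ B x) := this
    simp [h2]
  have hcont : ∀ i, Continuous fun x => ⟪e i, fderiv ℝ B x (e i)⟫ := fun i =>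
    continuous_const.inner ((hB.continuous_fderiv one_ne_zero).clm_apply continuous_const)
  have key : ∀ i, ∫ x, fderiv ℝ v x (e i) * ⟪e i, B x⟫ =
      -∫ x, ⟪e i, fderiv ℝ B x (e i)⟫ * v x := by
    intro i
    obtain ⟨C, hC⟩ := hlip i
    have h := LipschitzWith.integral_lineDeriv_mul_eq (μ := volume) hv hC (hBic i) (e i)
    rw [← integral_neg]
    trans ∫ x, lineDeriv ℝ v x (e i) * ⟪e i, B x⟫
    · refine integral_congr_ae ?_
      filter_upwards [hv.ae_differentiableAt] with x hx
      simp only [hx.lineDeriv_eq_fderiv]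
    · rw [h]
      congr 1
      ext x
      rw [((hBi i).differentiable one_ne_zero x).lineDeriv_eq_fderiv, map_neg, hfd, neg_mul]
  have hint1 : ∀ i, Integrable fun x => fderiv ℝ v x (e i) * ⟪e i, B x⟫ := by
    intro i
    have hc : Integrable fun x => ⟪e i, B x⟫ :=
      (hBi i).continuous.integrable_of_hasCompactSupport (hBic i)
    refine hc.bdd_mul (c := L * ‖e i‖) ?_ ?_
    · exact (measurable_fderiv_apply_const ℝ v (e i)).aestronglyMeasurable
    · refine .of_forall fun x => (ContinuousLinearMap.le_opNorm _ _).trans ?_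
      gcongr
      exact norm_fderiv_le_of_lipschitz ℝ hv
  have hint2 : ∀ i, Integrable fun x => ⟪e i, fderiv ℝ B x (e i)⟫ * v x := fun i =>
    ((hcont i).mul hv.continuous).integrable_of_hasCompactSupport hvc.mul_left
  calc ∫ x, ⟪B x, gradient v x⟫
      = ∫ x, ∑ i, fderiv ℝ v x (e i) * ⟪e i, B x⟫ := by
        congr 1
        ext x
        rw [← e.sum_inner_mul_inner]
        refine Finset.sum_congr rfl fun i _ => ?_
        rw [← inner_gradient_left, mul_comm, real_inner_comm, real_inner_comm (B x)]
    _ = ∑ i, ∫ x, fderiv ℝ v x (e i) * ⟪e i, B x⟫ := integral_finsetSum _ fun i _ => hint1 i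
    _ = -∑ i, ∫ x, ⟪e i, fderiv ℝ B x (e i)⟫ * v x := by simp [key]
    _ = -∫ x, ∑ i, ⟪e i, fderiv ℝ B x (e i)⟫ * v x := by
        rw [integral_finsetSum _ fun i _ => hint2 i]
    _ = _ := by
        congr 2
        ext x
        rw [LinearMap.trace_eq_sum_inner _ e, Finset.sum_mul]
        rfl

end IntegrationByParts

section Comparison

variable {N : ℕ}

theorem exists_lipschitzWith_eq_max_zero {h : EN N → ℝ} {x₀ : EN N} {r δ : ℝ} {K : NNReal}
    (hr : 0 < r) (hδ : 0 ≤ δ) (hh : LipschitzOnWith K h (ball x₀ r))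
    (hle : ∀ y ∈ ball x₀ r, h y ≤ δ) (hneg : ∀ y ∈ ball x₀ r, r / 2 ≤ dist y x₀ → h y ≤ 0) :
    ∃ (L : NNReal) (v : EN N → ℝ), LipschitzWith L v ∧
      (∀ y ∈ ball x₀ r, v y = max 0 (h y)) ∧ ∀ y ∉ ball x₀ r, v y = 0 := by
  obtain ⟨g, hg, hgeq⟩ := hh.extend_real
  have hc : LipschitzWith (0 + ‖2 * δ / r‖₊ * (0 + 1))
      fun y => 0 + (2 * δ / r) • (r - dist y x₀) :=
    (LipschitzWith.const 0).add ((lipschitzWith_smul (2 * δ / r)).comp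
      ((LipschitzWith.const r).sub (LipschitzWith.dist_left x₀)))
  refine ⟨_, fun y => max 0 (min (g y) (0 + (2 * δ / r) • (r - dist y x₀))),
    (LipschitzWith.const 0).max (hg.min hc), fun y hy => ?_, fun y hy => ?_⟩
  · simp only [← hgeq hy, zero_add, smul_eq_mul]
    rcases le_total (r / 2) (dist y x₀) with h1 | h1
    · rw [max_eq_left (hneg y hy h1), max_eq_left ((min_le_left _ _).trans (hneg y hy h1))]
    · rw [min_eq_left]
      refine (hle y hy).trans ?_
      calc δ = 2 * δ / r * (r - r / 2) := by field_simp; norm_num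
        _ ≤ _ := by gcongr
  · simp only [zero_add, smul_eq_mul]
    rw [max_eq_left]
    refine (min_le_right _ _).trans (mul_nonpos_of_nonneg_of_nonpos (by positivity) ?_)
    have : r ≤ dist y x₀ := not_lt.1 hy
    linarith

variable {f : ℝ → ℝ} {Ω : Set (EN N)}

theorem LipOn.integrableOn_comp_gradient (hf : StdF f) (hΩo : IsOpen Ω)
    (hΩb : Bornology.IsBounded Ω) {w : EN N → ℝ} (hw : LipOn w (closure Ω)) :
    IntegrableOn (fun x => f ‖gradient w x‖) Ω := by
  obtain ⟨L, hL⟩ := hw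
  obtain ⟨C, hC⟩ := (isCompact_closedBall (0 : EN N) L).exists_bound_of_continuousOn
    hf.continuous_comp_norm.continuousOn
  refine Measure.integrableOn_of_bounded (M := C) hΩb.measure_lt_top.ne
    (hf.continuous_comp_norm.measurable.comp (measurable_gradient w)).aestronglyMeasurable ?_
  filter_upwards [ae_restrict_mem hΩo.measurableSet] with x hx
  refine hC _ (mem_closedBall_zero_iff.2 ?_)
  exact norm_gradient_le (hΩo.mem_nhds hx) (hL.mono subset_closure)

theorem trace_fderiv_nonneg_of_minimizer (hf : StdF f) (hΩo : IsOpen Ω)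
    (hΩb : Bornology.IsBounded Ω) {u : EN N → ℝ} (hu : LipOn u (closure Ω))
    (hmin : ∀ w : EN N → ℝ, LipOn w (closure Ω) → EqOn w u (frontier Ω) → J f Ω u ≤ J f Ω w)
    {x₀ : EN N} (hx₀ : x₀ ∈ Ω) {Φ : EN N → ℝ} (hΦ : ContDiff ℝ 1 Φ) {B : EN N → EN N}
    (hB : ContDiff ℝ 1 B) (hBc : HasCompactSupport B)
    (hBΦ : ∀ᶠ y in 𝓝 x₀, ∀ q, f ‖gradient Φ y‖ + ⟪B y, q - gradient Φ y⟫ ≤ f ‖q‖)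
    (htouch : ∀ᶠ y in 𝓝 x₀, u y + ‖y - x₀‖ ^ 4 ≤ Φ y) (heq : u x₀ = Φ x₀) :
    0 ≤ LinearMap.trace ℝ (EN N) (fderiv ℝ B x₀).toLinearMap := by
  by_contra! htr
  have htrc : Continuous fun x => LinearMap.trace ℝ (EN N) (fderiv ℝ B x).toLinearMap := by
    simp only [LinearMap.trace_eq_sum_inner _ (EuclideanSpace.basisFun (Fin N) ℝ)]
    exact continuous_finsetSum _ fun i _ =>
      continuous_const.inner ((hB.continuous_fderiv one_ne_zero).clm_apply continuous_const)
  obtain ⟨KΦ, t, ht, hΦL⟩ := hΦ.contDiffAt.exists_lipschitzOnWith (x := x₀)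
  obtain ⟨r, hr, hball⟩ := Metric.eventually_nhds_iff_ball.1
    ((hΩo.eventually_mem hx₀).and ((Filter.eventually_mem_set.2 ht).and
        (hBΦ.and (htouch.and (htrc.continuousAt.eventually_lt_const htr)))))
  obtain ⟨Lu, hLu⟩ := hu
  set δ : ℝ := (r / 2) ^ 4 with hδ
  have hδ0 : 0 < δ := by positivity
  have hbΩ : ball x₀ r ⊆ Ω := fun y hy => (hball y hy).1
  have hh : LipschitzOnWith (Lu + KΦ + 0) (fun y => u y - Φ y + δ) (ball x₀ r) :=
    ((hLu.mono (hbΩ.trans subset_closure)).sub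
      (hΦL.mono fun y hy => (hball y hy).2.1)).add (LipschitzWith.const δ).lipschitzOnWith
  obtain ⟨L, v, hv, hvin, hvout⟩ := exists_lipschitzWith_eq_max_zero hr hδ0.le hh
    (fun y hy => by
      have := (hball y hy).2.2.2.1
      have : 0 ≤ ‖y - x₀‖ ^ 4 := by positivity
      linarith)
    (fun y hy hy2 => by
      have := (hball y hy).2.2.2.1
      rw [dist_eq_norm] at hy2
      have : δ ≤ ‖y - x₀‖ ^ 4 := by rw [hδ]; gcongr
      linarith)
  have hv0 : ∀ y, 0 ≤ v y := fun y => by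
    by_cases hy : y ∈ ball x₀ r
    · rw [hvin y hy]; exact le_max_left _ _
    · rw [hvout y hy]
  have hvc : HasCompactSupport v := .intro (isCompact_closedBall x₀ r) fun y hy =>
    hvout y fun h => hy (ball_subset_closedBall h)
  have hgrad0 : ∀ y, v y = 0 → fderiv ℝ v y = 0 := fun y hy =>
    IsLocalMin.fderiv_eq_zero (.of_forall fun z => by rw [hy]; exact hv0 z)
  have hdu : ∀ᵐ x ∂volume.restrict Ω, DifferentiableAt ℝ u x := by
    rw [ae_restrict_iff' hΩo.measurableSet]
    filter_upwards [(hLu.mono subset_closure).ae_differentiableWithinAt_of_mem] with x hx hxΩ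
    exact (hx hxΩ).differentiableAt (hΩo.mem_nhds hxΩ)
  have hwL : LipOn (fun x => u x - v x) (closure Ω) := ⟨_, hLu.sub hv.lipschitzOnWith⟩
  have hJ := hmin (fun x => u x - v x) hwL fun y hy => by
    have : y ∉ ball x₀ r := fun h => by
      rw [hΩo.frontier_eq] at hy
      exact hy.2 (hbΩ h)
    simp [hvout y this]
  have hpt : ∀ᵐ x ∂volume.restrict Ω,
      f ‖gradient (fun x => u x - v x) x‖ + ⟪B x, gradient v x⟫ ≤ f ‖gradient u x‖ := by
    filter_upwards [hdu, ae_restrict_of_ae hv.ae_differentiableAt] with x hux hvx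
    have hw : gradient (fun x => u x - v x) x = gradient u x - gradient v x := by
      simp only [gradient]
      rw [fderiv_fun_sub hux hvx, map_sub]
    rcases (hv0 x).eq_or_lt with h0 | hpos
    · have : gradient v x = 0 := by simp [gradient, hgrad0 x h0.symm]
      simp [hw, this]
    · have hxb : x ∈ ball x₀ r := by
        by_contra h
        exact hpos.ne' (hvout x h)
      have hev : v =ᶠ[𝓝 x] fun y => u y - Φ y + δ := by
        filter_upwards [isOpen_ball.mem_nhds hxb,
          hv.continuous.continuousAt.eventually_const_lt hpos] with y hy hy2
        rw [hvin y hy] at hy2 ⊢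
        exact max_eq_right_of_lt ((lt_max_iff.1 hy2).resolve_left (lt_irrefl _))
      have hgv : gradient v x = gradient u x - gradient Φ x := by
        simp only [gradient]
        rw [hev.fderiv_eq, fderiv_add_const,
          fderiv_fun_sub hux (hΦ.differentiable one_ne_zero x), map_sub]
      rw [hw, hgv, sub_sub_cancel]
      exact (hball x hxb).2.2.1 _
  have hBv : Integrable fun x => ⟪B x, gradient v x⟫ := by
    have hBi : Integrable fun x => L * ‖B x‖ :=
      (hB.continuous.integrable_of_hasCompactSupport hBc).norm.const_mul _
    refine hBi.mono'
      (hB.continuous.measurable.inner (measurable_gradient v)).aestronglyMeasurable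
      (.of_forall fun x => ?_)
    refine (norm_inner_le_norm _ _).trans ?_
    rw [mul_comm]
    gcongr
    exact norm_gradient_le univ_mem hv.lipschitzOnWith
  have hle : J f Ω (fun x => u x - v x) + ∫ x in Ω, ⟪B x, gradient v x⟫ ≤ J f Ω u := by
    have hi := hwL.integrableOn_comp_gradient hf hΩo hΩb
    rw [J, J, ← integral_add hi hBv.integrableOn]
    exact integral_mono_ae (hi.add hBv.integrableOn)
      (LipOn.integrableOn_comp_gradient hf hΩo hΩb ⟨Lu, hLu⟩) hpt
  have hset : ∫ x in Ω, ⟪B x, gradient v x⟫ = ∫ x, ⟪B x, gradient v x⟫ :=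
    setIntegral_eq_integral_of_forall_compl_eq_zero fun x hx => by
      simp [gradient, hgrad0 x (hvout x fun h => hx (hbΩ h))]
  have hpos : 0 < ∫ x, -(LinearMap.trace ℝ (EN N) (fderiv ℝ B x).toLinearMap * v x) := by
    refine (htrc.mul hv.continuous).neg.integral_pos_of_hasCompactSupport_nonneg_nonzero
      (x := x₀) hvc.mul_left.neg (fun y => ?_) ?_
    · by_cases hy : y ∈ ball x₀ r
      · exact neg_nonneg.2 (mul_nonpos_of_nonpos_of_nonneg (hball y hy).2.2.2.2.le (hv0 y))
      · simp [hvout y hy]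
    · have : v x₀ ≠ 0 := by
        rw [hvin x₀ (mem_ball_self hr), heq, sub_self, zero_add, max_eq_right hδ0.le]
        exact hδ0.ne'
      exact neg_ne_zero.2 (mul_ne_zero htr.ne this)
  rw [integral_neg, ← hv.integral_inner_gradient hvc hB hBc, ← hset] at hpos
  linarith

end Comparison

section TestFunctions

variable {N : ℕ}

theorem ContDiffAt.exists_contDiff_eventuallyEq {B : EN N → EN N} {x : EN N}
    (hB : ContDiffAt ℝ 1 B x) :
    ∃ B' : EN N → EN N, ContDiff ℝ 1 B' ∧ HasCompactSupport B' ∧ B' =ᶠ[𝓝 x] B := by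
  obtain ⟨r, hr, hball⟩ := Metric.eventually_nhds_iff_ball.1 (hB.eventually (by simp))
  let χ : ContDiffBump x := ⟨r / 4, r / 2, by positivity, by linarith⟩
  refine ⟨fun y => χ y • B y, ?_, χ.hasCompactSupport.smul_right, ?_⟩
  · refine contDiff_iff_contDiffAt.2 fun y => ?_
    by_cases hy : y ∈ tsupport χ
    swap
    · refine contDiffAt_const (c := (0 : EN N)) |>.congr_of_eventuallyEq ?_
      filter_upwards [notMem_tsupport_iff_eventuallyEq.1 hy] with z hz
      simp [hz]
    rw [χ.tsupport_eq] at hy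
    refine χ.contDiffAt.smul (hball y (closedBall_subset_ball ?_ hy))
    show r / 2 < r
    linarith
  · filter_upwards [χ.eventuallyEq_one] with y hy
    simp [hy]

theorem ContDiff.contDiff_gradient {φ : EN N → ℝ} (hφ : ContDiff ℝ 2 φ) :
    ContDiff ℝ 1 (gradient φ) :=
  (InnerProductSpace.toDual ℝ (EN N)).symm.contDiff.comp
    (hφ.fderiv_right (m := 1) (by norm_num))

theorem gradient_add_norm_sub_pow_four {φ : EN N → ℝ} (hφ : Differentiable ℝ φ) (c : ℝ)
    (x₀ y : EN N) : gradient (fun y => φ y + c + (‖y - x₀‖ ^ 2) ^ 2) y =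
      gradient φ y + (4 * ‖y - x₀‖ ^ 2) • (y - x₀) := by
  refine HasGradientAt.gradient (HasFDerivAt.congr_fderiv
    (((hφ y).hasFDerivAt.add_const c).add
      (((hasStrictFDerivAt_norm_sq (y - x₀)).hasFDerivAt.comp y
        ((hasFDerivAt_id y).sub_const x₀)).pow 2)) ?_)
  ext z
  simp
  ring

theorem hasFDerivAt_norm_sq_smul_sub (x₀ : EN N) :
    HasFDerivAt (fun y : EN N => (4 * ‖y - x₀‖ ^ 2) • (y - x₀)) (0 : EN N →L[ℝ] EN N) x₀ := by
  have h : HasFDerivAt (fun y : EN N => y - x₀) (ContinuousLinearMap.id ℝ (EN N)) x₀ :=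
    (hasFDerivAt_id x₀).sub_const x₀
  refine ((h.norm_sq.const_mul 4).smul h).congr_fderiv ?_
  ext z
  simp

end TestFunctions

section Viscosity

variable {N : ℕ} {f : ℝ → ℝ} {Ω : Set (EN N)}

theorem operator_nonpos_of_isLocalMaxOn (hf : StdF f) (hΩo : IsOpen Ω)
    (hΩb : Bornology.IsBounded Ω) {u : EN N → ℝ} (hu : LipOn u (closure Ω))
    (hmin : ∀ w : EN N → ℝ, LipOn w (closure Ω) → EqOn w u (frontier Ω) → J f Ω u ≤ J f Ω w)
    {α : ℝ → ℝ} (hα : ∀ ρ : ℝ, α ρ = if ρ = 0 then 0 else ρ * deriv (dtop f) ρ / dtop f ρ)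
    {x₀ : EN N} (hx₀ : x₀ ∈ Ω) {φ : EN N → ℝ} (hφ : ContDiff ℝ 2 φ)
    (hmax : IsLocalMaxOn (fun y => u y - φ y) Ω x₀) :
    -(α ‖gradient φ x₀‖ - 1) * ⟪fderiv ℝ (gradient φ) x₀ (gradient φ x₀), gradient φ x₀⟫
      - ‖gradient φ x₀‖ ^ 2 *
        LinearMap.trace ℝ (EN N) (fderiv ℝ (gradient φ) x₀).toLinearMap ≤ 0 := by
  by_cases hp : gradient φ x₀ = 0
  · simp [hp]
  set Φ : EN N → ℝ := fun y => φ y + (u x₀ - φ x₀) + (‖y - x₀‖ ^ 2) ^ 2 with hΦdef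
  have hΦ : ContDiff ℝ 2 Φ :=
    (hφ.add contDiff_const).add (((contDiff_id.sub contDiff_const).norm_sq ℝ).pow 2)
  have hgΦ : gradient Φ = fun y => gradient φ y + (4 * ‖y - x₀‖ ^ 2) • (y - x₀) :=
    funext fun y => gradient_add_norm_sub_pow_four (hφ.differentiable two_ne_zero) _ x₀ y
  have hgx : gradient Φ x₀ = gradient φ x₀ := by simp [hgΦ]
  have hG : HasFDerivAt (gradient Φ) (fderiv ℝ (gradient φ) x₀) x₀ := by
    rw [hgΦ]
    exact ((hφ.contDiff_gradient.differentiable one_ne_zero x₀).hasFDerivAt.add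
      (hasFDerivAt_norm_sq_smul_sub x₀)).congr_fderiv (add_zero _)
  have hB₀ : ContDiffAt ℝ 1 (fun y => flux f (gradient Φ y)) x₀ :=
    (hf.contDiffAt_flux (by rwa [hgx])).comp x₀ hΦ.contDiff_gradient.contDiffAt
  obtain ⟨B, hB, hBc, hBeq⟩ := hB₀.exists_contDiff_eventuallyEq
  have htr := trace_fderiv_nonneg_of_minimizer hf hΩo hΩb hu hmin hx₀ (hΦ.of_le one_le_two) hB hBc
    (by
      filter_upwards [hBeq, hΦ.contDiff_gradient.continuous.continuousAt.eventually_ne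
        (show gradient Φ x₀ ≠ 0 by rwa [hgx])] with y hy hy0 q
      rw [hy]
      exact hf.add_inner_flux_le hy0 q)
    (by
      rw [IsLocalMaxOn, hΩo.nhdsWithin_eq hx₀] at hmax
      filter_upwards [hmax] with y hy
      simp only [hΦdef]
      have : ‖y - x₀‖ ^ 4 = (‖y - x₀‖ ^ 2) ^ 2 := by ring
      linarith)
    (by simp [hΦdef])
  rw [hBeq.fderiv_eq] at htr
  have hid := hf.trace_fderiv_flux_comp hG (by rwa [hgx])
  rw [hgx] at hid
  have hd := hf.dtop_pos (norm_nonneg (gradient φ x₀))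
  have hnn : 0 ≤ ‖gradient φ x₀‖ ^ 3 / dtop f ‖gradient φ x₀‖ * LinearMap.trace ℝ (EN N)
      (fderiv ℝ (fun y => flux f (gradient Φ y)) x₀).toLinearMap := by positivity
  rw [hα, if_neg (norm_ne_zero_iff.2 hp)]
  linarith

theorem gradient_fun_neg (φ : EN N → ℝ) :
    gradient (fun y => -φ y) = fun x => -gradient φ x := by
  ext1 x
  simp only [gradient]
  rw [fderiv_fun_neg, map_neg]

theorem J_neg (f : ℝ → ℝ) (Ω : Set (EN N)) (w : EN N → ℝ) :
    J f Ω (fun y => -w y) = J f Ω w := by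
  simp [J, gradient_fun_neg]

theorem LipOn.neg {w : EN N → ℝ} {s : Set (EN N)} (hw : LipOn w s) : LipOn (fun y => -w y) s :=
  hw.imp fun _ h => h.neg

end Viscosity

/-- Under the bounded slope condition, and assuming
`α(ρ) = ρ f''(ρ)/f'(ρ)` has a finite limit at `0⁺` and a strictly positive limit `α∞` at
`+∞` (with `α(0) := 0`), every solution of the variational problem (P) is a viscosity
solution of `−[α(‖∇u‖) − 1]·Δ∞u − ‖∇u‖²·Δu = 0` in `Ω`. -/
theorem minimizer_is_viscositySolution
    (N : ℕ) (f : ℝ → ℝ) (hf : StdF f)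
    (Ω : Set (EN N)) (hΩo : IsOpen Ω) (hΩb : Bornology.IsBounded Ω)
    (ψ : EN N → ℝ) (hψ : ContinuousOn ψ (frontier Ω))
    (Q : ℝ) (hQ : 0 < Q) (hbsc : BSC Ω ψ Q)
    (hlim0 : ∃ ℓ : ℝ, Tendsto (fun ρ => ρ * deriv (dtop f) ρ / dtop f ρ)
      (nhdsWithin 0 (Set.Ioi 0)) (nhds ℓ))
    (αinf : ℝ) (hαinf : 0 < αinf)
    (hliminf : Tendsto (fun ρ => ρ * deriv (dtop f) ρ / dtop f ρ) atTop (nhds αinf))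
    (α : ℝ → ℝ)
    (hα : ∀ ρ : ℝ, α ρ = if ρ = 0 then 0 else ρ * deriv (dtop f) ρ / dtop f ρ)
    (u : EN N → ℝ) (hu : SolvesP f Ω ψ u) :
    ViscositySol Ω
      (fun p H => -(α ‖p‖ - 1) * ⟪H p, p⟫
        - ‖p‖ ^ 2 * LinearMap.trace ℝ (EN N) H.toLinearMap) u := by
  obtain ⟨huL, huψ, hmin⟩ := hu
  have hmin' : ∀ w : EN N → ℝ, LipOn w (closure Ω) → EqOn w u (frontier Ω) →
      J f Ω u ≤ J f Ω w := fun w hw hwu => hmin w hw (hwu.trans huψ)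
  refine ⟨?_, fun x hx φ hφ hmax => ?_, fun x hx φ hφ hmn => ?_⟩
  · obtain ⟨L, hL⟩ := huL
    exact hL.continuousOn.mono subset_closure
  · exact operator_nonpos_of_isLocalMaxOn hf hΩo hΩb huL hmin' hα hx hφ hmax
  · have hneg : ∀ w : EN N → ℝ, LipOn w (closure Ω) → EqOn w (fun y => -u y) (frontier Ω) →
        J f Ω (fun y => -u y) ≤ J f Ω w := fun w hw hwu => by
      rw [J_neg, ← J_neg f Ω w]
      exact hmin' _ hw.neg fun y hy => by simp [hwu hy]
    have h := operator_nonpos_of_isLocalMaxOn hf hΩo hΩb huL.neg hneg hα hx hφ.neg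
      (by simpa [sub_eq_add_neg, add_comm] using hmn.neg)
    rw [gradient_fun_neg, fderiv_fun_neg] at h
    simp only [norm_neg, neg_apply, map_neg, neg_neg, inner_neg_right,
      ContinuousLinearMap.toLinearMap_neg] at h
    linarith
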